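/- Let (E, g) be a polymatroid, let d ∈ ℝ^E with d_e > 0 for all e, and let φ : ℝ_{≥0} → ℝ be strictly convex and continuously differentiable. A base x ∈ B(g) minimizes the d-separable objective Σ_{e ∈ E} d_e · φ(x(e)/d_e) over all bases of (E, g) if and only if x is the lexicographically optimal base of (E, g) with respect to the weight vector d. -/

import Mathlib

/-- A rank function on the finite ground set `Fin n`: nonnegative, zero on `∅`,
nondecreasing and submodular.  `(E, g)` is then a polymatroid. -/
def IsRankFunction {n : ℕ} (g : Finset (Fin n) → ℝ) : Prop :=
  g ∅ = 0 ∧ (∀ A, 0 ≤ g A) ∧ (∀ A B : Finset (Fin n), A ⊆ B → g A ≤ g B) ∧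
    ∀ A B : Finset (Fin n), g (A ∪ B) + g (A ∩ B) ≤ g A + g B

/-- The polymatroidal polyhedron `P(g)` of independent vectors. -/
def polyP {n : ℕ} (g : Finset (Fin n) → ℝ) : Set (Fin n → ℝ) :=
  {x | (∀ e, 0 ≤ x e) ∧ ∀ A : Finset (Fin n), ∑ e ∈ A, x e ≤ g A}

/-- The base `B(g)` of the polymatroid `(E, g)`. -/
def polyBase {n : ℕ} (g : Finset (Fin n) → ℝ) : Set (Fin n → ℝ) :=
  {x ∈ polyP g | ∑ e, x e = g Finset.univ}

/-- `T(x)`: the components of `x` arranged in nondecreasing order. -/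
noncomputable def sortedTuple {n : ℕ} (x : Fin n → ℝ) : Fin n → ℝ :=
  x ∘ Tuple.sort x

/-- `a` is lexicographically greater than or equal to `b`. -/
def LexGE {n : ℕ} (a b : Fin n → ℝ) : Prop :=
  a = b ∨ ∃ j : Fin n, (∀ i < j, a i = b i) ∧ b j < a j

/-- `x` is an `h`-lexicographically optimal base of `(E, g)`: `x ∈ B(g)` and the
sorted tuple `T(h(x))` is lexicographically maximum among all `T(h(y))`, `y ∈ B(g)`. -/
def IsLexOptimalBase {n : ℕ} (g : Finset (Fin n) → ℝ) (h : Fin n → ℝ → ℝ)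
    (x : Fin n → ℝ) : Prop :=
  x ∈ polyBase g ∧ ∀ y ∈ polyBase g,
    LexGE (sortedTuple (fun e => h e (x e))) (sortedTuple (fun e => h e (y e)))

open Finset in
theorem aux_exchange {n : ℕ} (g : Finset (Fin n) → ℝ) (hg : IsRankFunction g)
    (x : Fin n → ℝ) (hx : x ∈ polyBase g) (A : Finset (Fin n)) (hA : ¬ g A ≤ ∑ e ∈ A, x e) :
    ∃ e ∈ A, ∃ f, f ∉ A ∧ ∀ S : Finset (Fin n), e ∈ S → f ∉ S → ∑ i ∈ S, x i < g S := by
  by_contra hcon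
  push Not at hcon
  obtain ⟨h0, -, -, hsub⟩ := hg
  obtain ⟨⟨-, hP⟩, hE⟩ := hx
  have key : ∀ S T : Finset (Fin n), g S ≤ ∑ i ∈ S, x i → g T ≤ ∑ i ∈ T, x i →
      g (S ∪ T) ≤ ∑ i ∈ S ∪ T, x i ∧ g (S ∩ T) ≤ ∑ i ∈ S ∩ T, x i := by
    intro S T hS hT
    have h1 := Finset.sum_union_inter (s₁ := S) (s₂ := T) (f := x)
    have h2 := hsub S T
    have h3 := hP (S ∪ T)
    have h4 := hP (S ∩ T)
    constructor <;> linarith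
  have step : ∀ e ∈ A, ∃ D : Finset (Fin n), e ∈ D ∧ D ⊆ A ∧ g D ≤ ∑ i ∈ D, x i := by
    intro e he
    choose! S hS using hcon e he
    refine ⟨Aᶜ.inf S, ?_, ?_, ?_⟩
    · rw [Finset.mem_inf]
      intro f hf
      exact (hS f (by simpa using hf)).1
    · intro i hi
      by_contra hiA
      rw [Finset.mem_inf] at hi
      exact (hS i hiA).2.1 (hi i (by simpa using hiA))
    · refine Finset.inf_induction (p := fun D => g D ≤ ∑ i ∈ D, x i) ?_ ?_ ?_
      · show g univ ≤ ∑ i, x i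
        exact hE.ge
      · intro S hS T hT
        exact (key S T hS hT).2
      · intro f hf
        exact (hS f (by simpa using hf)).2.2
  choose! D hD using step
  have hAD : A.sup D = A := by
    ext i
    rw [Finset.mem_sup]
    constructor
    · rintro ⟨e, he, hi⟩
      exact (hD e he).2.1 hi
    · intro hi
      exact ⟨i, hi, (hD i hi).1⟩
  apply hA
  rw [← hAD]
  refine Finset.sup_induction (p := fun D => g D ≤ ∑ i ∈ D, x i) ?_ ?_ ?_
  · show g ∅ ≤ ∑ i ∈ (∅ : Finset (Fin n)), x i
    simp [h0]
  · intro S hS T hT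
    exact (key S T hS hT).1
  · intro e he
    exact (hD e he).2.2

/-- The tightness condition on all level sets. -/
def AuxTight {n : ℕ} (g : Finset (Fin n) → ℝ) (d x : Fin n → ℝ) : Prop :=
  ∀ t : ℝ, g (Finset.univ.filter fun e => x e / d e ≤ t) ≤
    ∑ e ∈ Finset.univ.filter (fun e => x e / d e ≤ t), x e

theorem aux_improve {n : ℕ} (g : Finset (Fin n) → ℝ) (hg : IsRankFunction g)
    (d : Fin n → ℝ) (hd : ∀ e, 0 < d e)
    (x : Fin n → ℝ) (hx : x ∈ polyBase g) (hC : ¬ AuxTight g d x) :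
    ∃ y ∈ polyBase g, ∃ e f : Fin n, e ≠ f ∧ (∀ i, i ≠ e → i ≠ f → y i = x i) ∧
      ∃ δ : ℝ, 0 < δ ∧ y e = x e + δ ∧ y f = x f - δ ∧ y e / d e < y f / d f := by
  unfold AuxTight at hC
  push Not at hC
  obtain ⟨t, ht⟩ := hC
  obtain ⟨e, he, f, hf, hS⟩ := aux_exchange g hg x hx _ (not_le.mpr ht)
  simp only [Finset.mem_filter, Finset.mem_univ, true_and, not_le] at he hf
  obtain ⟨⟨hpos, hP⟩, hE⟩ := hx
  have hab : x e / d e < x f / d f := he.trans_lt hf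
  have hef : e ≠ f := by
    rintro rfl
    exact lt_irrefl _ hab
  have hfpos : 0 < x f := by
    have : 0 < x f / d f := lt_of_le_of_lt (div_nonneg (hpos e) (hd e).le) hab
    exact (div_pos_iff_of_pos_right (hd f)).1 this
  have small : ∀ c : ℝ, 0 < c → ∀ᶠ δ in nhdsWithin (0:ℝ) (Set.Ioi 0), δ < c := fun c hc =>
    (eventually_lt_nhds hc).filter_mono nhdsWithin_le_nhds
  have h1 : ∀ᶠ δ in nhdsWithin (0:ℝ) (Set.Ioi 0), ∀ S : Finset (Fin n), e ∈ S → f ∉ S →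
      δ < g S - ∑ i ∈ S, x i := by
    rw [Filter.eventually_all]
    intro S
    by_cases h : e ∈ S ∧ f ∉ S
    · filter_upwards [small _ (sub_pos.2 (hS S h.1 h.2))] with δ hδ _ _ using hδ
    · exact Filter.Eventually.of_forall fun δ a b => absurd ⟨a, b⟩ h
  have hden : 0 < 1 / d e + 1 / d f := add_pos (one_div_pos.2 (hd e)) (one_div_pos.2 (hd f))
  obtain ⟨δ, hδS, hδf, hδab, hδ0⟩ := (h1.and ((small _ hfpos).and
    ((small _ (div_pos (sub_pos.2 hab) hden)).and self_mem_nhdsWithin))).exists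
  have hδ0' : 0 < δ := hδ0
  have hsum : ∀ S : Finset (Fin n),
      ∑ i ∈ S, (x i + ((if i = e then δ else 0) - (if i = f then δ else 0))) =
      ∑ i ∈ S, x i + ((if e ∈ S then δ else 0) - (if f ∈ S then δ else 0)) := by
    intro S
    rw [Finset.sum_add_distrib, Finset.sum_sub_distrib, Finset.sum_ite_eq', Finset.sum_ite_eq']
  refine ⟨fun i => x i + ((if i = e then δ else 0) - (if i = f then δ else 0)),
    ⟨⟨?_, ?_⟩, ?_⟩, e, f, hef, ?_, δ, hδ0', ?_, ?_, ?_⟩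
  · intro i
    have := hpos i
    dsimp only
    by_cases h : i = f
    · subst h
      simp [hef.symm]
      exact hδf.le
    · simp only [h, if_false]
      split_ifs <;> linarith
  · intro S
    rw [hsum]
    have := hP S
    by_cases h : e ∈ S <;> by_cases h' : f ∈ S
    · simpa [h, h'] using this
    · have := hδS S h h'
      simp [h, h']
      linarith
    · simp [h, h']
      linarith
    · simpa [h, h'] using this
  · rw [hsum]
    simpa using hE
  · intro i h h'
    simp [h, h']
  · simp [hef]
  · simp [hef.symm, sub_eq_add_neg]
  · rw [lt_div_iff₀ hden] at hδab
    have e1 : (x e + δ) / d e = x e / d e + δ * (1 / d e) := by ring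
    have e2 : (x f - δ) / d f = x f / d f - δ * (1 / d f) := by ring
    have e3 : δ * (1 / d e + 1 / d f) = δ * (1 / d e) + δ * (1 / d f) := by ring
    simp only [hef, hef.symm, if_true, if_false, sub_zero, zero_sub, ← sub_eq_add_neg]
    rw [e1, e2]
    linarith

theorem aux_sorted_le {n : ℕ} (u : Fin n → ℝ) (k : Fin n) (s : ℝ) :
    sortedTuple u k ≤ s ↔ (k : ℕ) < (Finset.univ.filter fun i => u i ≤ s).card := by
  have h := Tuple.lt_card_le_iff_apply_le_of_monotone (f := sortedTuple u) (a := s) (j := k)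
    (Tuple.monotone_sort u)
  rw [← h]
  have : (Finset.univ.filter fun i => sortedTuple u i ≤ s).card =
      (Finset.univ.filter fun i => u i ≤ s).card := by
    rw [← Fintype.card_subtype, ← Fintype.card_subtype]
    exact Fintype.card_congr ((Tuple.sort u).subtypeEquiv fun i => Iff.rfl)
  rw [← this]

theorem aux_lex {n : ℕ} (p q : Fin n → ℝ) (a : ℝ)
    (h1 : ∀ s < a, (Finset.univ.filter fun i => p i ≤ s) = (Finset.univ.filter fun i => q i ≤ s))
    (h2 : (Finset.univ.filter fun i => p i ≤ a) ⊂ (Finset.univ.filter fun i => q i ≤ a)) :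
    LexGE (sortedTuple p) (sortedTuple q) ∧ ¬ LexGE (sortedTuple q) (sortedTuple p) := by
  have hc := Finset.card_lt_card h2
  have hn : (Finset.univ.filter fun i => q i ≤ a).card ≤ n := by
    simpa using Finset.card_le_univ (Finset.univ.filter fun i => q i ≤ a)
  obtain ⟨j, hj⟩ : ∃ j : Fin n, (j : ℕ) = (Finset.univ.filter fun i => p i ≤ a).card :=
    ⟨⟨_, hc.trans_le hn⟩, rfl⟩
  have hqj : sortedTuple q j ≤ a := (aux_sorted_le q j a).2 (hj ▸ hc)
  have hpj : a < sortedTuple p j := by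
    rw [← not_le, aux_sorted_le, hj]
    exact lt_irrefl _
  have heq : ∀ i < j, sortedTuple p i = sortedTuple q i := by
    intro i hi
    have hi' : (i : ℕ) < j := hi
    have hpi : sortedTuple p i ≤ a := (aux_sorted_le p i a).2 (hj ▸ hi')
    have hqi : sortedTuple q i ≤ a := (aux_sorted_le q i a).2 ((hj ▸ hi').trans hc)
    rcases lt_trichotomy (sortedTuple p i) (sortedTuple q i) with h | h | h
    · have := (aux_sorted_le p i _).1 le_rfl
      rw [h1 _ (h.trans_le hqi), ← aux_sorted_le] at this
      exact absurd this (not_le.2 h)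
    · exact h
    · have := (aux_sorted_le q i _).1 le_rfl
      rw [← h1 _ (h.trans_le hpi), ← aux_sorted_le] at this
      exact absurd this (not_le.2 h)
  refine ⟨Or.inr ⟨j, heq, hqj.trans_lt hpj⟩, ?_⟩
  rintro (h | ⟨k, hk, hk'⟩)
  · rw [h] at hqj
    exact absurd hqj (not_le.2 hpj)
  · rcases lt_trichotomy k j with h | h | h
    · exact absurd hk' (by rw [heq k h]; exact lt_irrefl _)
    · subst h
      linarith
    · have := hk j h
      linarith

theorem aux_tight_lex {n : ℕ} (g : Finset (Fin n) → ℝ)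
    (d : Fin n → ℝ) (hd : ∀ e, 0 < d e)
    (x : Fin n → ℝ) (hC : AuxTight g d x) (y : Fin n → ℝ)
    (hy : y ∈ polyBase g) (hxy : y ≠ x) :
    LexGE (sortedTuple fun e => x e / d e) (sortedTuple fun e => y e / d e) ∧
    ¬ LexGE (sortedTuple fun e => y e / d e) (sortedTuple fun e => x e / d e) := by
  obtain ⟨e0, he0⟩ := Function.ne_iff.1 hxy
  have hne : (Finset.univ.filter fun e => y e ≠ x e).Nonempty := ⟨e0, by simpa using he0⟩
  obtain ⟨e, he, hemin⟩ := Finset.exists_min_image _ (fun e => x e / d e) hne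
  obtain ⟨f, hf, hfmin⟩ := Finset.exists_min_image _ (fun e => y e / d e) hne
  simp only [Finset.mem_filter, Finset.mem_univ, true_and] at he hemin hf hfmin
  have hlt : y f / d f < x e / d e := by
    by_contra hcon
    push Not at hcon
    have h1 := (hC (x e / d e)).trans' (hy.1.2 _)
    refine absurd h1 (not_le.2 (Finset.sum_lt_sum ?_ ⟨e, by simp, ?_⟩))
    · intro i hi
      simp only [Finset.mem_filter, Finset.mem_univ, true_and] at hi
      by_cases h : y i = x i
      · exact h.ge
      · exact (div_le_div_iff_of_pos_right (hd i)).1 ((hi.trans hcon).trans (hfmin i h))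
    · exact lt_of_le_of_ne ((div_le_div_iff_of_pos_right (hd e)).1 (hcon.trans (hfmin e he)))
        (Ne.symm he)
  refine aux_lex _ _ (y f / d f) ?_ ?_
  · intro s hs
    ext i
    simp only [Finset.mem_filter, Finset.mem_univ, true_and]
    by_cases h : y i = x i
    · rw [h]
    · have := hemin i h
      have := hfmin i h
      constructor <;> intro _ <;> linarith
  · rw [Finset.ssubset_iff_of_subset]
    · refine ⟨f, by simp, ?_⟩
      have := hemin f hf
      simp only [Finset.mem_filter, Finset.mem_univ, true_and]
      linarith
    · intro i hi
      simp only [Finset.mem_filter, Finset.mem_univ, true_and] at hi ⊢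
      by_cases h : y i = x i
      · rwa [h]
      · have := hemin i h
        linarith

theorem aux_lex_tight {n : ℕ} (g : Finset (Fin n) → ℝ) (hg : IsRankFunction g)
    (d : Fin n → ℝ) (hd : ∀ e, 0 < d e) (x : Fin n → ℝ)
    (h : IsLexOptimalBase g (fun e t => t / d e) x) : AuxTight g d x := by
  by_contra hC
  obtain ⟨y, hy, e, f, hef, hoth, δ, hδ, hye, hyf, hlt⟩ := aux_improve g hg d hd x h.1 hC
  have h1 : x e / d e < y e / d e := by
    rw [div_lt_div_iff_of_pos_right (hd e)]
    linarith
  have h2 : y f / d f < x f / d f := by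
    rw [div_lt_div_iff_of_pos_right (hd f)]
    linarith
  refine (aux_lex (fun e => y e / d e) (fun e => x e / d e) (x e / d e) ?_ ?_).2 (h.2 y hy)
  · intro s hs
    ext i
    simp only [Finset.mem_filter, Finset.mem_univ, true_and]
    by_cases hi : i = e
    · subst hi
      constructor <;> intro _ <;> linarith
    by_cases hi' : i = f
    · subst hi'
      constructor <;> intro _ <;> linarith
    rw [hoth i hi hi']
  · rw [Finset.ssubset_iff_of_subset]
    · refine ⟨e, by simp, ?_⟩
      simp only [Finset.mem_filter, Finset.mem_univ, true_and]
      linarith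
    · intro i hi
      simp only [Finset.mem_filter, Finset.mem_univ, true_and] at hi ⊢
      by_cases hie : i = e
      · rw [hie]
      by_cases hi' : i = f
      · subst hi'
        linarith
      · rwa [← hoth i hie hi']

theorem aux_opt_tight {n : ℕ} (g : Finset (Fin n) → ℝ) (hg : IsRankFunction g)
    (d : Fin n → ℝ) (hd : ∀ e, 0 < d e) 
    (φ : ℝ → ℝ) (hφ : StrictConvexOn ℝ (Set.Ici 0) φ)
    (x : Fin n → ℝ) (hx : x ∈ polyBase g)
    (h : ∀ y ∈ polyBase g,
        ∑ e, d e * φ (x e / d e) ≤ ∑ e, d e * φ (y e / d e)) : AuxTight g d x := by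
  by_contra hC
  obtain ⟨y, hy, e, f, hef, hoth, δ, hδ, hye, hyf, hlt⟩ := aux_improve g hg d hd x hx hC
  have hde := hd e
  have hdf := hd f
  have h1 : x e / d e < y e / d e := by
    rw [div_lt_div_iff_of_pos_right (hd e)]
    linarith
  have h2 : y f / d f < x f / d f := by
    rw [div_lt_div_iff_of_pos_right (hd f)]
    linarith
  have p1 : 0 ≤ x e / d e := div_nonneg (hx.1.1 e) hde.le
  have p2 : 0 ≤ y e / d e := div_nonneg (hy.1.1 e) hde.le
  have p3 : 0 ≤ y f / d f := div_nonneg (hy.1.1 f) hdf.le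
  have p4 : 0 ≤ x f / d f := div_nonneg (hx.1.1 f) hdf.le
  have s1 := hφ.slope_strict_mono_adjacent (x := x e / d e) (z := y f / d f) p1 p3 h1 hlt
  have s2 := hφ.slope_strict_mono_adjacent (x := y e / d e) (z := x f / d f) p2 p4 hlt h2
  have s3 := s1.trans s2
  have e1 : y e / d e - x e / d e = δ / d e := by rw [hye]; ring
  have e2 : x f / d f - y f / d f = δ / d f := by rw [hyf]; ring
  rw [e1, e2, div_div_eq_mul_div, div_div_eq_mul_div, div_lt_div_iff_of_pos_right hδ] at s3
  have hsum := h y hy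
  rw [← sub_nonneg, ← Finset.sum_sub_distrib,
    Fintype.sum_eq_add e f hef (fun i hi => by rw [hoth i hi.1 hi.2, sub_self])] at hsum
  nlinarith

theorem aux_compact {n : ℕ} (g : Finset (Fin n) → ℝ) : IsCompact (polyBase g) := by
  have hcl : IsClosed (polyBase g) := by
    have : polyBase g = ((⋂ e, {x : Fin n → ℝ | 0 ≤ x e}) ∩
        ⋂ A : Finset (Fin n), {x : Fin n → ℝ | ∑ e ∈ A, x e ≤ g A}) ∩
        {x | ∑ e, x e = g Finset.univ} := by
      ext x
      simp [polyBase, polyP]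
    rw [this]
    refine IsClosed.inter (IsClosed.inter ?_ ?_) ?_
    · exact isClosed_iInter fun e => isClosed_le (by fun_prop) (by fun_prop)
    · exact isClosed_iInter fun e => isClosed_le (by fun_prop) (by fun_prop)
    · exact isClosed_eq (by fun_prop) (by fun_prop)
  refine (isCompact_Icc (a := (0 : Fin n → ℝ)) (b := fun e => g {e})).of_isClosed_subset hcl ?_
  intro x hx
  refine ⟨fun e => hx.1.1 e, fun e => ?_⟩
  simpa using hx.1.2 {e}

/-- A base `x ∈ B(g)` minimizes the `d`-separable objective
`∑_e d_e · φ(x(e)/d_e)` over `B(g)` if and only if `x` is the lexicographically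
optimal base of `(E, g)` with respect to the weight vector `d`
(i.e. `h`-lexicographically optimal for `h_e(t) = t/d_e`). -/
theorem base_isOptimal_iff_lexOptimal_weight (n : ℕ) (g : Finset (Fin n) → ℝ)
    (hg : IsRankFunction g) (d : Fin n → ℝ) (hd : ∀ e, 0 < d e)
    (φ : ℝ → ℝ) (hφ : StrictConvexOn ℝ (Set.Ici 0) φ)
    (hφ' : ContDiffOn ℝ 1 φ (Set.Ici 0))
    (x : Fin n → ℝ) (hx : x ∈ polyBase g) :
    (∀ y ∈ polyBase g,
        ∑ e, d e * φ (x e / d e) ≤ ∑ e, d e * φ (y e / d e)) ↔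
      IsLexOptimalBase g (fun e t => t / d e) x := by
  constructor
  · intro h
    have hC := aux_opt_tight g hg d hd φ hφ x hx h
    refine ⟨hx, fun y hy => ?_⟩
    by_cases hxy : y = x
    · rw [hxy]
      exact Or.inl rfl
    · exact (aux_tight_lex g d hd x hC y hy hxy).1
  · intro h
    have hC := aux_lex_tight g hg d hd x h
    have hcont : ContinuousOn (fun y : Fin n → ℝ => ∑ e, d e * φ (y e / d e)) (polyBase g) := by
      refine continuousOn_finsetSum _ fun e _ => ContinuousOn.mul continuousOn_const ?_
      refine hφ'.continuousOn.comp (by fun_prop) ?_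
      intro y hy
      exact div_nonneg (hy.1.1 e) (hd e).le
    obtain ⟨z, hz, hmin⟩ := (aux_compact g).exists_isMinOn ⟨x, hx⟩ hcont
    have hzopt : ∀ y ∈ polyBase g,
        ∑ e, d e * φ (z e / d e) ≤ ∑ e, d e * φ (y e / d e) := fun y hy => hmin hy
    have hzC := aux_opt_tight g hg d hd φ hφ z hz hzopt
    by_cases hxz : z = x
    · rwa [hxz] at hzopt
    · exact absurd (aux_tight_lex g d hd z hzC x hx (Ne.symm hxz)).1
        (aux_tight_lex g d hd x hC z hz hxz).2
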